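/- Let u : D → ℝⁿ be C² with u(ζ) = (ξ, η, 0, …, 0) + O(|ζ|²) near 0 (where ζ = ξ + iη). Then Δ(|u|)(ζ) = (1/|ζ|)(1 + O(|ζ|)) as ζ → 0, ζ ≠ 0; in particular there exist constants c, r₀ > 0 such that Δ(|u|)(ζ) ≥ c/|ζ| for 0 < |ζ| < r₀. -/

import Mathlib

open Metric Topology

lemma second_deriv_norm {E F : Type*} [NormedAddCommGroup E] [NormedSpace ℝ E]
    [NormedAddCommGroup F] [InnerProductSpace ℝ F] {u : E → F} {z : E}
    (hu : ContDiffAt ℝ 2 u z) (h0 : u z ≠ 0) (v : E) :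
    fderiv ℝ (fderiv ℝ (fun w => ‖u w‖)) z v v =
      (‖fderiv ℝ u z v‖ ^ 2 + inner ℝ (u z) (fderiv ℝ (fderiv ℝ u) z v v)) / ‖u z‖
        - inner ℝ (u z) (fderiv ℝ u z v) ^ 2 / ‖u z‖ ^ 3 := by
  have hg : ContDiffAt ℝ 2 (fun w => ‖u w‖) z := hu.norm ℝ h0
  have first : ∀ w, DifferentiableAt ℝ u w → u w ≠ 0 →
      HasFDerivAt (fun w => ‖u w‖) (‖u w‖⁻¹ • (innerSL ℝ (u w)).comp (fderiv ℝ u w)) w := by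
    intro w hd hw
    have h1 := hd.hasFDerivAt.norm_sq.sqrt (by positivity)
    have h2 : (fun y => ‖u y‖) = fun y => √(‖u y‖ ^ 2) := by
      funext y; rw [Real.sqrt_sq (norm_nonneg _)]
    rw [h2]
    convert h1 using 1
    rw [Real.sqrt_sq (norm_nonneg _), two_nsmul, ← two_smul ℝ, smul_smul]
    congr 1
    have : ‖u w‖ ≠ 0 := norm_ne_zero_iff.2 hw
    field_simp
  have hd1 : ∀ᶠ w in 𝓝 z, DifferentiableAt ℝ u w := by
    filter_upwards [hu.eventually (by simp)] with w hw
    exact hw.differentiableAt (by norm_num)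
  have hne : ∀ᶠ w in 𝓝 z, u w ≠ 0 := hu.continuousAt.eventually_ne h0
  have hu1 : DifferentiableAt ℝ (fderiv ℝ u) z :=
    (hu.fderiv_right (m := 1) (by norm_num)).differentiableAt (by norm_num)
  have hg1 : DifferentiableAt ℝ (fderiv ℝ (fun w => ‖u w‖)) z :=
    (hg.fderiv_right (m := 1) (by norm_num)).differentiableAt (by norm_num)
  have e1 : fderiv ℝ (fun w => fderiv ℝ (fun w => ‖u w‖) w v) z v =
      fderiv ℝ (fderiv ℝ (fun w => ‖u w‖)) z v v := by
    rw [fderiv_clm_apply hg1 (differentiableAt_const v)]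
    simp
  have e2 : (fun w => fderiv ℝ (fun w => ‖u w‖) w v) =ᶠ[𝓝 z]
      fun w => ‖u w‖⁻¹ * inner ℝ (u w) (fderiv ℝ u w v) := by
    filter_upwards [hd1, hne] with w h1 h2
    rw [(first w h1 h2).fderiv]
    simp
  have h3 : HasFDerivAt (fun w => fderiv ℝ u w v) ((fderiv ℝ (fderiv ℝ u) z).flip v) z := by
    have := hu1.hasFDerivAt.clm_apply (hasFDerivAt_const v z)
    simpa using this
  have hn0 : ‖u z‖ ≠ 0 := norm_ne_zero_iff.2 h0
  have hd : DifferentiableAt ℝ u z := hu.differentiableAt (by norm_num)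
  have h4 := ((hasDerivAt_inv hn0).comp_hasFDerivAt z (first z hd h0)).mul
    (hd.hasFDerivAt.inner ℝ h3)
  have h5 : HasFDerivAt (fun w => ‖u w‖⁻¹ * inner ℝ (u w) (fderiv ℝ u w v)) _ z := h4
  rw [← e1, e2.fderiv_eq, h5.fderiv]
  simp [fderivInnerCLM_apply]
  field_simp
  ring

lemma est {F : Type*} [NormedAddCommGroup F] [InnerProductSpace ℝ F]
    {u a b w₁ w₂ E₁ E₂ : F} {K r x y : ℝ} (hr : 0 < r) (hK : 0 < K) (hKr : K * r ≤ 1 / 2)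
    (hE₁ : ‖E₁‖ = 1) (hE₂ : ‖E₂‖ = 1) (hE : inner ℝ E₁ E₂ = (0 : ℝ))
    (hxy : r ^ 2 = x ^ 2 + y ^ 2) (hu : ‖u - (x • E₁ + y • E₂)‖ ≤ K * r ^ 2)
    (ha : ‖a - E₁‖ ≤ K * r) (hb : ‖b - E₂‖ ≤ K * r) (hw₁ : ‖w₁‖ ≤ K) (hw₂ : ‖w₂‖ ≤ K) :
    u ≠ 0 ∧ |(((‖a‖ ^ 2 + inner ℝ u w₁) / ‖u‖ - inner ℝ u a ^ 2 / ‖u‖ ^ 3) +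
      ((‖b‖ ^ 2 + inner ℝ u w₂) / ‖u‖ - inner ℝ u b ^ 2 / ‖u‖ ^ 3)) * r - 1| ≤ 100 * K * r := by
  set q := x • E₁ + y • E₂ with hq
  have hE' : inner ℝ E₂ E₁ = (0 : ℝ) := by rw [real_inner_comm]; exact hE
  have hqn : ‖q‖ = r := by
    have : ‖q‖ ^ 2 = r ^ 2 := by
      rw [hq, norm_add_sq_real, norm_smul, norm_smul, hE₁, hE₂, inner_smul_left, inner_smul_right,
        hE, hxy]
      simp
    exact (sq_eq_sq₀ (norm_nonneg _) hr.le).1 this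
  have hq1 : inner ℝ q E₁ = x := by
    simp [hq, inner_add_left, inner_smul_left, hE', hE₁]
  have hq2 : inner ℝ q E₂ = y := by
    simp [hq, inner_add_left, inner_smul_left, hE, hE₂]
  have htr : |‖u‖ - r| ≤ K * r ^ 2 := by
    rw [← hqn]; rw [hqn]; exact (hqn ▸ abs_norm_sub_norm_le u q).trans hu
  have hKr2 : K * r ^ 2 ≤ r / 2 := by nlinarith
  have ht : r / 2 ≤ ‖u‖ := by have := (abs_le.1 htr).1; linarith
  have htpos : 0 < ‖u‖ := by linarith
  refine ⟨norm_pos_iff.1 htpos, ?_⟩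
  set t := ‖u‖ with htdef
  set n := t⁻¹ • u with hn
  set p := r⁻¹ • q with hp
  have hut : u = t • n := by rw [hn, smul_smul, mul_inv_cancel₀ htpos.ne', one_smul]
  have hnn : ‖n‖ = 1 := by
    rw [hn, norm_smul, norm_inv, Real.norm_of_nonneg htpos.le, ← htdef, inv_mul_cancel₀ htpos.ne']
  have hnp : ‖n - p‖ ≤ 2 * K * r := by
    have h1 : r • (n - p) = (u - q) + (r - t) • n := by
      have hrp : r • p = q := by rw [hp, smul_smul, mul_inv_cancel₀ hr.ne', one_smul]
      rw [smul_sub, hrp, sub_smul, ← hut]; abel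
    have h2 : r * ‖n - p‖ ≤ K * r ^ 2 + K * r ^ 2 := by
      rw [← Real.norm_of_nonneg hr.le, ← norm_smul, Real.norm_of_nonneg hr.le, h1]
      refine (norm_add_le _ _).trans (add_le_add hu ?_)
      rw [norm_smul, hnn, mul_one, Real.norm_eq_abs, abs_sub_comm]
      exact htr
    nlinarith
  have key : ∀ c E : F, ‖E‖ = 1 → ‖c - E‖ ≤ K * r → |inner ℝ q E| ≤ r →
      |‖c‖ ^ 2 - 1| ≤ 5 / 2 * (K * r) ∧
      |inner ℝ n c ^ 2 - (inner ℝ q E / r) ^ 2| ≤ 10 * (K * r) := by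
    intro c E hE1 hc hqE
    have h1 : |‖c‖ - 1| ≤ K * r := by
      have := abs_norm_sub_norm_le c E
      rw [hE1] at this; exact this.trans hc
    have h2 : ‖c‖ ≤ 3 / 2 := by have := (abs_le.1 h1).2; linarith
    have hc0 := norm_nonneg c
    have hKr0 : 0 < K * r := by positivity
    constructor
    · have : ‖c‖ ^ 2 - 1 = (‖c‖ + 1) * (‖c‖ - 1) := by ring
      rw [this, abs_mul, abs_of_nonneg (by linarith : 0 ≤ ‖c‖ + 1)]
      exact mul_le_mul (by linarith) h1 (abs_nonneg _) (by norm_num)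
    · have h3 : |inner ℝ n c| ≤ 3 / 2 := by
        have := abs_real_inner_le_norm n c
        rw [hnn, one_mul] at this; linarith
      have h4 : |inner ℝ q E / r| ≤ 1 := by
        rw [abs_div, abs_of_pos hr]; exact (div_le_one hr).2 hqE
      have hpn : ‖p‖ = 1 := by
        rw [hp, norm_smul, norm_inv, Real.norm_of_nonneg hr.le, hqn, inv_mul_cancel₀ hr.ne']
      have h5 : inner ℝ n c - inner ℝ q E / r = inner ℝ (n - p) c + inner ℝ p (c - E) := by
        have hpE : inner ℝ p E = inner ℝ q E / r := by
          rw [hp, inner_smul_left]; simp only [conj_trivial]; ring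
        rw [inner_sub_left, inner_sub_right, hpE]; ring
      have h6 : |inner ℝ n c - inner ℝ q E / r| ≤ 4 * (K * r) := by
        rw [h5]
        have i1 := abs_real_inner_le_norm (n - p) c
        have i2 := abs_real_inner_le_norm p (c - E)
        rw [hpn, one_mul] at i2
        have i3 : ‖n - p‖ * ‖c‖ ≤ (2 * K * r) * (3 / 2) :=
          mul_le_mul hnp h2 hc0 (by positivity)
        refine (abs_add_le _ _).trans ?_
        linarith
      have : inner ℝ n c ^ 2 - (inner ℝ q E / r) ^ 2 =
        (inner ℝ n c + inner ℝ q E / r) * (inner ℝ n c - inner ℝ q E / r) := by ring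
      rw [this, abs_mul]
      have h7 := abs_add_le (inner ℝ n c) (inner ℝ q E / r)
      have h8 := mul_le_mul (by linarith : |inner ℝ n c + inner ℝ q E / r| ≤ 5 / 2) h6
        (abs_nonneg _) (by norm_num)
      linarith
  obtain ⟨ka1, ka2⟩ := key a E₁ hE₁ ha (by
    have := abs_real_inner_le_norm q E₁; rwa [hqn, hE₁, mul_one] at this)
  obtain ⟨kb1, kb2⟩ := key b E₂ hE₂ hb (by
    have := abs_real_inner_le_norm q E₂; rwa [hqn, hE₂, mul_one] at this)
  rw [hq1] at ka2
  rw [hq2] at kb2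
  set Q := ‖a‖ ^ 2 + ‖b‖ ^ 2 - inner ℝ n a ^ 2 - inner ℝ n b ^ 2 with hQ
  have hQ1 : |Q - 1| ≤ 25 * (K * r) := by
    have h1 : (x / r) ^ 2 + (y / r) ^ 2 = 1 := by
      field_simp; linarith
    have := abs_le.1 ka1
    have := abs_le.1 ka2
    have := abs_le.1 kb1
    have := abs_le.1 kb2
    rw [abs_le]; constructor <;> linarith
  have hrt : r / t ≤ 2 := by rw [div_le_iff₀ htpos]; linarith
  have hrt0 : 0 < r / t := by positivity
  have hrt1 : |r / t - 1| ≤ 2 * (K * r) := by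
    have : r / t - 1 = (r - t) / t := by field_simp
    rw [this, abs_div, abs_of_pos htpos, div_le_iff₀ htpos, abs_sub_comm]
    have : K * r * (r / 2) ≤ K * r * t := by gcongr
    nlinarith
  have eq : (((‖a‖ ^ 2 + inner ℝ u w₁) / t - inner ℝ u a ^ 2 / t ^ 3) +
      ((‖b‖ ^ 2 + inner ℝ u w₂) / t - inner ℝ u b ^ 2 / t ^ 3)) * r - 1 =
      (r / t) * (Q - 1) + (r / t - 1) + r * inner ℝ n w₁ + r * inner ℝ n w₂ := by
    have s : ∀ c, inner ℝ u c = t * inner ℝ n c := by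
      intro c
      rw [hn, inner_smul_left]
      simp only [conj_trivial]
      field_simp
    rw [s, s, s, s, hQ]
    field_simp
    ring
  rw [eq]
  have iw : ∀ w : F, ‖w‖ ≤ K → |r * inner ℝ n w| ≤ K * r := by
    intro w hw
    have := abs_real_inner_le_norm n w
    rw [hnn, one_mul] at this
    rw [abs_mul, abs_of_pos hr, mul_comm]
    have := this.trans hw
    gcongr
  have l1 := iw w₁ hw₁
  have l2 := iw w₂ hw₂
  have l3 : |(r / t) * (Q - 1)| ≤ 2 * (25 * (K * r)) := by
    rw [abs_mul, abs_of_pos hrt0]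
    exact mul_le_mul hrt hQ1 (abs_nonneg _) (by norm_num)
  have hKr0 : 0 < K * r := by positivity
  have := abs_le.1 l1
  have := abs_le.1 l2
  have := abs_le.1 l3
  have := abs_le.1 hrt1
  rw [abs_le]; constructor <;> linarith

lemma second_bdd {E F : Type*} [NormedAddCommGroup E] [NormedSpace ℝ E]
    [NormedAddCommGroup F] [NormedSpace ℝ F] {u : E → F} {z : E}
    (hu : ContDiffAt ℝ 2 u z) : ∃ M : ℝ, 0 ≤ M ∧ ∃ s ∈ 𝓝 z, ∀ y ∈ s, ∀ e : E, ‖e‖ = 1 →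
      ‖fderiv ℝ (fderiv ℝ u) y e e‖ ≤ M := by
  have hU1 : ContDiffAt ℝ 1 (fderiv ℝ u) z := hu.fderiv_right (by norm_num)
  have hU2 : ContinuousAt (fderiv ℝ (fderiv ℝ u)) z :=
    (hU1.fderiv_right (m := 0) (by norm_num)).continuousAt
  have hc : ContinuousAt (fun y => ‖fderiv ℝ (fderiv ℝ u) y‖) z :=
    ContinuousAt.norm (E := E →L[ℝ] E →L[ℝ] F) hU2
  have h : ∀ᶠ y in 𝓝 z, ‖fderiv ℝ (fderiv ℝ u) y‖ < ‖fderiv ℝ (fderiv ℝ u) z‖ + 1 :=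
    hc.eventually (gt_mem_nhds (lt_add_one _))
  refine ⟨‖fderiv ℝ (fderiv ℝ u) z‖ + 1, by positivity, _, h, fun y hy e he => ?_⟩
  have h1 := (fderiv ℝ (fderiv ℝ u) y).le_opNorm₂ e e
  rw [he, mul_one, mul_one] at h1
  exact h1.trans (le_of_lt hy)


noncomputable section

open Metric

/-- First standard basis vector of `ℝ²`. -/
def e₁ : EuclideanSpace ℝ (Fin 2) := EuclideanSpace.single 0 1

/-- Second standard basis vector of `ℝ²`. -/
def e₂ : EuclideanSpace ℝ (Fin 2) := EuclideanSpace.single 1 1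

/-- Laplacian (within a set `s`) of a map `f : ℝ² → F` at `z`:
`Δf(z) = ∂²f/∂x²(z) + ∂²f/∂y²(z)`. -/
def lapW {F : Type*} [NormedAddCommGroup F] [NormedSpace ℝ F]
    (s : Set (EuclideanSpace ℝ (Fin 2))) (f : EuclideanSpace ℝ (Fin 2) → F)
    (z : EuclideanSpace ℝ (Fin 2)) : F :=
  iteratedFDerivWithin ℝ 2 f s z ![e₁, e₁] + iteratedFDerivWithin ℝ 2 f s z ![e₂, e₂]

/-- Euclidean Hessian of `ρ : ℝⁿ → ℝ` at `p`, as a bilinear form. -/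
def hess {n : ℕ} (ρ : EuclideanSpace ℝ (Fin n) → ℝ) (p v w : EuclideanSpace ℝ (Fin n)) : ℝ :=
  iteratedFDeriv ℝ 2 ρ p ![v, w]

/-- If `u : D → ℝⁿ` is `C²` with `u(ζ) = (ξ,η,0,…,0) + O(|ζ|²)`, then
`Δ(|u|)(ζ) = (1/|ζ|)(1 + O(|ζ|))` as `ζ → 0`; in particular `Δ(|u|)(ζ) ≥ c/|ζ|` for
`0 < |ζ| < r₀` and suitable `c, r₀ > 0`. -/
theorem stmt12 {n : ℕ} (hn : 2 ≤ n)
    (u : EuclideanSpace ℝ (Fin 2) → EuclideanSpace ℝ (Fin n))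
    (hu : ContDiffOn ℝ 2 u (ball 0 1)) (hu0 : u 0 = 0)
    (hO : ∃ C₀ : ℝ, ∀ ζ ∈ ball (0 : EuclideanSpace ℝ (Fin 2)) 1,
      ‖u ζ - (EuclideanSpace.single (⟨0, by omega⟩ : Fin n) (ζ 0) +
        EuclideanSpace.single (⟨1, by omega⟩ : Fin n) (ζ 1))‖ ≤ C₀ * ‖ζ‖ ^ 2)
    (hdu : fderivWithin ℝ u (ball 0 1) 0 e₁ = EuclideanSpace.single (⟨0, by omega⟩ : Fin n) 1 ∧
      fderivWithin ℝ u (ball 0 1) 0 e₂ = EuclideanSpace.single (⟨1, by omega⟩ : Fin n) 1) :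
    ∃ C > 0, ∃ r₀ > 0,
      (∀ ζ : EuclideanSpace ℝ (Fin 2), ζ ≠ 0 → ‖ζ‖ < r₀ →
        |lapW (ball 0 1 \ {0}) (fun w => ‖u w‖) ζ * ‖ζ‖ - 1| ≤ C * ‖ζ‖) ∧
      ∃ c > 0, ∀ ζ : EuclideanSpace ℝ (Fin 2), ζ ≠ 0 → ‖ζ‖ < r₀ →
        c / ‖ζ‖ ≤ lapW (ball 0 1 \ {0}) (fun w => ‖u w‖) ζ := by
  obtain ⟨C₀, hO⟩ := hO
  have hball : ball (0 : EuclideanSpace ℝ (Fin 2)) 1 ∈ 𝓝 0 := ball_mem_nhds _ one_pos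
  have hU : ContDiffAt ℝ 2 u 0 := hu.contDiffAt hball
  rw [fderivWithin_of_mem_nhds hball] at hdu
  have hU1 : ContDiffAt ℝ 1 (fderiv ℝ u) 0 := hU.fderiv_right (by norm_num)
  obtain ⟨L, s, hs, hL⟩ := hU1.exists_lipschitzOnWith
  obtain ⟨M, hM0, s2, hs2, hM⟩ := second_bdd hU
  obtain ⟨r1, hr1, hsub⟩ := Metric.mem_nhds_iff.1 (Filter.inter_mem hs hs2)
  have hL0 : (0 : ℝ) ≤ L := L.2
  set K := |C₀| + L + M + 1 with hKdef
  have hC0 := le_abs_self C₀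
  have hC1 := abs_nonneg C₀
  have hK : 0 < K := by positivity
  have ne1 : ‖e₁‖ = 1 := by simp [e₁]
  have ne2 : ‖e₂‖ = 1 := by simp [e₂]
  have main : ∀ ζ : EuclideanSpace ℝ (Fin 2), ζ ≠ 0 → ‖ζ‖ < min (min r1 1) (1 / (200 * K)) →
        |lapW (ball 0 1 \ {0}) (fun w => ‖u w‖) ζ * ‖ζ‖ - 1| ≤ 100 * K * ‖ζ‖ := by
    intro ζ hζ hlt
    have l1 : ‖ζ‖ < r1 := hlt.trans_le ((min_le_left _ _).trans (min_le_left _ _))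
    have l2 : ‖ζ‖ < 1 := hlt.trans_le ((min_le_left _ _).trans (min_le_right _ _))
    have l3 : ‖ζ‖ < 1 / (200 * K) := hlt.trans_le (min_le_right _ _)
    rw [lt_div_iff₀ (by positivity)] at l3
    have hζs := hsub (mem_ball_zero_iff.2 l1)
    have h0s := hsub (mem_ball_self hr1)
    have hζb : ζ ∈ ball (0 : EuclideanSpace ℝ (Fin 2)) 1 := mem_ball_zero_iff.2 l2
    have hr : 0 < ‖ζ‖ := norm_pos_iff.2 hζ
    have hUζ : ContDiffAt ℝ 2 u ζ := hu.contDiffAt (isOpen_ball.mem_nhds hζb)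
    have hlip : ‖fderiv ℝ u ζ - fderiv ℝ u 0‖ ≤ L * ‖ζ‖ := by
      have := hL.dist_le_mul ζ hζs.1 0 h0s.1
      simpa [dist_eq_norm] using this
    have hlip' : ∀ e : EuclideanSpace ℝ (Fin 2), ‖e‖ = 1 →
        ‖fderiv ℝ u ζ e - fderiv ℝ u 0 e‖ ≤ K * ‖ζ‖ := by
      intro e he
      have := (fderiv ℝ u ζ - fderiv ℝ u 0).le_opNorm e
      rw [he, mul_one] at this
      refine (this.trans hlip).trans ?_
      gcongr
      linarith
    have hw : ∀ e : EuclideanSpace ℝ (Fin 2), ‖e‖ = 1 →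
        ‖fderiv ℝ (fderiv ℝ u) ζ e e‖ ≤ K := by
      intro e he
      have := hM ζ hζs.2 e he
      linarith
    have hx := est (u := u ζ) (a := fderiv ℝ u ζ e₁) (b := fderiv ℝ u ζ e₂)
      (w₁ := fderiv ℝ (fderiv ℝ u) ζ e₁ e₁) (w₂ := fderiv ℝ (fderiv ℝ u) ζ e₂ e₂)
      (E₁ := EuclideanSpace.single (⟨0, by omega⟩ : Fin n) (1 : ℝ))
      (E₂ := EuclideanSpace.single (⟨1, by omega⟩ : Fin n) (1 : ℝ))
      (K := K) (r := ‖ζ‖) (x := ζ 0) (y := ζ 1) hr hK (by linarith)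
      (by simp) (by simp) (by simp [EuclideanSpace.inner_single_left])
      (by simp [EuclideanSpace.norm_sq_eq])
      (by
        have h1 := hO ζ hζb
        have e : ∀ (i : Fin n) (c : ℝ), c • EuclideanSpace.single i (1 : ℝ) =
            EuclideanSpace.single i c := by
          intro i c; ext j; by_cases h : j = i <;> simp [h]
        rw [e, e]
        refine h1.trans ?_
        gcongr
        linarith)
      (by rw [← hdu.1]; exact hlip' _ ne1) (by rw [← hdu.2]; exact hlip' _ ne2)
      (hw _ ne1) (hw _ ne2)
    have hopen : IsOpen (ball (0 : EuclideanSpace ℝ (Fin 2)) 1 \ {0}) :=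
      isOpen_ball.sdiff isClosed_singleton
    have hmem : ζ ∈ ball (0 : EuclideanSpace ℝ (Fin 2)) 1 \ {0} := ⟨hζb, hζ⟩
    have hlap : lapW (ball 0 1 \ {0}) (fun w => ‖u w‖) ζ =
        fderiv ℝ (fderiv ℝ (fun w => ‖u w‖)) ζ e₁ e₁ +
        fderiv ℝ (fderiv ℝ (fun w => ‖u w‖)) ζ e₂ e₂ := by
      rw [lapW, iteratedFDerivWithin_of_isOpen 2 hopen hmem, iteratedFDeriv_two_apply,
        iteratedFDeriv_two_apply]
      simp
    rw [hlap, second_deriv_norm hUζ hx.1, second_deriv_norm hUζ hx.1]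
    exact hx.2
  refine ⟨100 * K, by positivity, min (min r1 1) (1 / (200 * K)), by positivity, main,
    1 / 2, by norm_num, ?_⟩
  intro ζ hζ hlt
  have h1 := (abs_le.1 (main ζ hζ hlt)).1
  have l3 : ‖ζ‖ < 1 / (200 * K) := hlt.trans_le (min_le_right _ _)
  rw [lt_div_iff₀ (by positivity)] at l3
  rw [div_le_iff₀ (norm_pos_iff.2 hζ)]
  linarith
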